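/- If ν ∈ ℝ^c satisfies Nᵀ ν = Nᵀ B, then the set {u ∈ ℝ^m : A_i ⬝ u ≤ B_i for all i with ν_i ≥ 0} is nonempty; that is, enforcing exactly those constraints whose indices correspond to nonnegative components of ν yields a feasible constraint set. -/

import Mathlib

open Matrix

/-- A vector orthogonal to the null space of a matrix lies in its row space. -/
theorem Matrix.exists_transpose_mulVec_eq {K m n : Type*} [Field K] [Fintype m] [Fintype n]
    (A : Matrix m n K) (w : n → K) (hw : ∀ l, A *ᵥ l = 0 → w ⬝ᵥ l = 0) :
    ∃ u, Aᵀ *ᵥ u = w := by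
  classical
  by_contra hu
  have hmem : w ∉ LinearMap.range Aᵀ.mulVecLin := fun ⟨u, h⟩ => hu ⟨u, h⟩
  obtain ⟨f, hfw, hf⟩ := Submodule.exists_le_ker_of_notMem hmem
  obtain ⟨l, rfl⟩ := (dotProductEquiv K n).surjective f
  have hl : ∀ x, dotProductEquiv K n l x = l ⬝ᵥ x := fun _ => rfl
  rw [hl, dotProduct_comm] at hfw
  refine hfw (hw l (dotProduct_eq_zero _ fun u => ?_))
  have h : l ⬝ᵥ Aᵀ *ᵥ u = 0 := hf ⟨u, rfl⟩
  rwa [dotProduct_mulVec, vecMul_transpose] at h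

/-- If `Nᵀ ν = Nᵀ B` (with the columns of `N` spanning `null(A)`), then enforcing
exactly the constraints whose indices have nonnegative `ν`-components yields a feasible set. -/
theorem stmt_10 (m c k : ℕ) (hm : 0 < m) (hc : 0 < c) (hk : 0 < k)
    (A : Matrix (Fin m) (Fin c) ℝ) (B : Fin c → ℝ)
    (N : Matrix (Fin c) (Fin k) ℝ)
    (hN : {l : Fin c → ℝ | A.mulVec l = 0} = {l : Fin c → ℝ | ∃ μ : Fin k → ℝ, l = N.mulVec μ})
    (ν : Fin c → ℝ) (hν : Nᵀ.mulVec ν = Nᵀ.mulVec B) :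
    {u : Fin m → ℝ | ∀ i, 0 ≤ ν i → Aᵀ.mulVec u i ≤ B i}.Nonempty := by
  obtain ⟨u, hu⟩ := A.exists_transpose_mulVec_eq (B - ν) fun l hl => by
    obtain ⟨μ, rfl⟩ := hN.subset hl
    rw [dotProduct_mulVec, ← mulVec_transpose, mulVec_sub, hν, sub_self, zero_dotProduct]
  refine ⟨u, fun i hi => ?_⟩
  rw [hu, Pi.sub_apply]
  linarith
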